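/- arXiv:2202.08932 — 5 statements merged into one kernel-verified Lean document; each statement's English description precedes it below -/
import Mathlib

section
/- Every ternary cubic form f over ℂ has Waring rank at most 5, and rank(f) = 5 if and only if f = a·(a·c + b²) for some linearly independent linear forms a, b, c. -/
open MvPolynomial

/-- Ternary forms: polynomials in three variables over `ℂ`. -/
abbrev Ternary : Type := MvPolynomial (Fin 3) ℂ

/-- A linear form is a homogeneous polynomial of degree 1. -/
def IsLinearForm (a : Ternary) : Prop := MvPolynomial.IsHomogeneous a 1

/-- The Waring rank of a form `f` (with respect to degree `d`): the least `r`
such that `f` is a sum of `r` `d`-th powers of linear forms. -/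
noncomputable def waringRank (d : ℕ) (f : Ternary) : ℕ :=
  sInf {r : ℕ | ∃ l : Fin r → Ternary, (∀ i, IsLinearForm (l i)) ∧ f = ∑ i, (l i) ^ d}

/-- The Hessian determinant of a ternary form: the determinant of the matrix of
second partial derivatives. -/
noncomputable def hess (f : Ternary) : Ternary :=
  Matrix.det (Matrix.of fun i j : Fin 3 =>
    MvPolynomial.pderiv i (MvPolynomial.pderiv j f))

/-- `[abc]`: the determinant of the 3×3 matrix whose rows are the coefficients of
the linear forms `a`, `b`, `c`. -/
noncomputable def bracket (a b c : Ternary) : ℂ :=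
  Matrix.det (Matrix.of
    ![![MvPolynomial.coeff (Finsupp.single 0 1) a, MvPolynomial.coeff (Finsupp.single 1 1) a,
        MvPolynomial.coeff (Finsupp.single 2 1) a],
      ![MvPolynomial.coeff (Finsupp.single 0 1) b, MvPolynomial.coeff (Finsupp.single 1 1) b,
        MvPolynomial.coeff (Finsupp.single 2 1) b],
      ![MvPolynomial.coeff (Finsupp.single 0 1) c, MvPolynomial.coeff (Finsupp.single 1 1) c,
        MvPolynomial.coeff (Finsupp.single 2 1) c]])

lemma IsLinearForm.add {a b : Ternary} (ha : IsLinearForm a) (hb : IsLinearForm b) :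
    IsLinearForm (a + b) :=
  MvPolynomial.IsHomogeneous.add ha hb

lemma IsLinearForm.sub {a b : Ternary} (ha : IsLinearForm a) (hb : IsLinearForm b) :
    IsLinearForm (a - b) :=
  MvPolynomial.IsHomogeneous.sub ha hb

lemma IsLinearForm.C_mul {a : Ternary} (ha : IsLinearForm a) (t : ℂ) :
    IsLinearForm (C t * a) :=
  MvPolynomial.IsHomogeneous.C_mul ha t

/-- `f` is a sum of `n` cubes of linear forms (some of which may vanish). -/
def IsCubeSum (n : ℕ) (f : Ternary) : Prop :=
  ∃ l : Fin n → Ternary, (∀ i, IsLinearForm (l i)) ∧ f = ∑ i, (l i) ^ 3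

lemma exists_cube_root (t : ℂ) : ∃ s : ℂ, s ^ 3 = t :=
  IsAlgClosed.exists_pow_nat_eq t (by norm_num)

lemma exists_square_root (t : ℂ) : ∃ s : ℂ, s ^ 2 = t :=
  IsAlgClosed.exists_pow_nat_eq t (by norm_num)

lemma IsCubeSum.add {m n : ℕ} {f g : Ternary} (hf : IsCubeSum m f) (hg : IsCubeSum n g) :
    IsCubeSum (m + n) (f + g) := by
  obtain ⟨l, hl, rfl⟩ := hf
  obtain ⟨k, hk, rfl⟩ := hg
  refine ⟨Fin.append l k, fun i => ?_, by simp [Fin.sum_univ_add]⟩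
  induction i using Fin.addCases with
  | left i => simpa using hl i
  | right i => simpa using hk i

lemma isCubeSum_zero (n : ℕ) : IsCubeSum n 0 :=
  ⟨fun _ => 0, fun _ => MvPolynomial.isHomogeneous_zero _ _ _, by simp⟩

lemma IsCubeSum.mono {m n : ℕ} {f : Ternary} (hf : IsCubeSum m f) (h : m ≤ n) :
    IsCubeSum n f := by
  simpa [Nat.add_sub_cancel' h] using hf.add (isCubeSum_zero (n - m))

lemma IsCubeSum.C_mul {n : ℕ} {f : Ternary} (hf : IsCubeSum n f) (t : ℂ) :
    IsCubeSum n (C t * f) := by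
  obtain ⟨l, hl, rfl⟩ := hf
  obtain ⟨s, rfl⟩ := exists_cube_root t
  exact ⟨fun i => C s * l i, fun i => (hl i).C_mul s, by simp [mul_pow, Finset.mul_sum]⟩

lemma IsLinearForm.isCubeSum {a : Ternary} (ha : IsLinearForm a) : IsCubeSum 1 (a ^ 3) :=
  ⟨fun _ => a, fun _ => ha, by simp⟩

lemma isCubeSum_sq_mul {x y : Ternary} (hx : IsLinearForm x) (hy : IsLinearForm y) :
    IsCubeSum 3 (x ^ 2 * y) := by
  have h := (((hx.add hy).isCubeSum.C_mul (1 / 6)).add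
    ((hx.sub hy).isCubeSum.C_mul (-1 / 6))).add (hy.isCubeSum.C_mul (-2 / 6))
  convert h using 1
  have h1 : (C (-1 / 6) : Ternary) = - C (1 / 6) := by rw [← C_neg]; norm_num
  have h2 : (C (-2 / 6) : Ternary) = - 2 * C (1 / 6) := by
    rw [show (-2 / 6 : ℂ) = - (1 / 6 + 1 / 6) by norm_num, C_neg, C_add]; ring
  have h6 : (6 : Ternary) * C (1 / 6) = 1 := by
    rw [show (6 : Ternary) = C 6 from (map_ofNat C 6).symm, ← C_mul]; norm_num
  rw [h1, h2]
  linear_combination (-(x ^ 2 * y)) * h6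

lemma isCubeSum_depressed {x y : Ternary} (hx : IsLinearForm x) (hy : IsLinearForm y)
    {b e : ℂ} (h : e ^ 2 + 4 * b ^ 3 ≠ 0) :
    IsCubeSum 2 (y ^ 3 + 3 * C b * x ^ 2 * y + C e * x ^ 3) := by
  by_cases hb : b = 0
  · subst hb
    simpa using hy.isCubeSum.add (hx.isCubeSum.C_mul e)
  obtain ⟨w, hw⟩ := exists_square_root ((e / b) ^ 2 + 4 * b)
  have hw' : w ^ 2 * b ^ 2 = e ^ 2 + 4 * b ^ 3 := by rw [hw]; field_simp
  have hw0 : w ≠ 0 := by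
    rintro rfl
    exact h (by rw [← hw']; ring)
  obtain ⟨m, hm⟩ : ∃ m, m = (e / b + w) / 2 := ⟨_, rfl⟩
  obtain ⟨n, hn⟩ : ∃ n, n = (e / b - w) / 2 := ⟨_, rfl⟩
  obtain ⟨p, hp⟩ : ∃ p, p = - n / w := ⟨_, rfl⟩
  obtain ⟨q, hq⟩ : ∃ q, q = m / w := ⟨_, rfl⟩
  have h0 : p + q = 1 := by rw [hp, hq, hm, hn]; field_simp; ring
  have h1 : p * m + q * n = 0 := by rw [hp, hq]; ring
  have h2 : p * m ^ 2 + q * n ^ 2 = b := by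
    rw [hp, hq, hm, hn]; field_simp; linear_combination 2 * b * w * hw'
  have h3 : p * m ^ 3 + q * n ^ 3 = e := by
    rw [hp, hq, hm, hn]; field_simp; linear_combination 4 * e * b * w * hw'
  have key := (((hy.add (hx.C_mul m)).isCubeSum).C_mul p).add
    (((hy.add (hx.C_mul n)).isCubeSum).C_mul q)
  convert key using 1
  have g0 := congrArg (C : ℂ → Ternary) h0
  have g1 := congrArg (C : ℂ → Ternary) h1
  have g2 := congrArg (C : ℂ → Ternary) h2
  have g3 := congrArg (C : ℂ → Ternary) h3
  simp only [map_add, map_mul, map_pow, map_one, map_zero] at g0 g1 g2 g3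
  linear_combination (-y ^ 3) * g0 - 3 * y ^ 2 * x * g1 - 3 * y * x ^ 2 * g2 - x ^ 3 * g3

lemma isCubeSum_mul_sum_sq {x y : Ternary} (hx : IsLinearForm x) (hy : IsLinearForm y)
    {c e : ℂ} (he : e ≠ 0) :
    IsCubeSum 2 (C c * x * y ^ 2 + C e * x ^ 3) := by
  obtain ⟨m, hm⟩ := exists_square_root (c / (3 * e))
  have key := (((hx.add (hy.C_mul m)).isCubeSum).C_mul (e / 2)).add
    (((hx.sub (hy.C_mul m)).isCubeSum).C_mul (e / 2))
  convert key using 1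
  have g1 : (C e : Ternary) = C (e / 2) + C (e / 2) := by rw [← C_add]; congr 1; ring
  have g2 : (C c : Ternary) = C (e / 2) * 6 * C m ^ 2 := by
    rw [show (6 : Ternary) = C 6 from (map_ofNat C 6).symm, ← C_pow, ← C_mul, ← C_mul, hm]
    congr 1; field_simp; ring
  rw [g1, g2]; ring

/-- In the pencil spanned by `x³` and a binary cubic not divisible by `x²`, all but at most two
members (the multiples of `x³` aside) are sums of two cubes. -/
lemma exists_isCubeSum_two {x y : Ternary} (hx : IsLinearForm x) (hy : IsLinearForm y)
    (b c d : ℂ) (h : c ≠ 0 ∨ d ≠ 0) :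
    ∃ r s : ℂ, ∀ t, t ≠ r → t ≠ s →
      IsCubeSum 2 (C t * x ^ 3 + C b * x ^ 2 * y + C c * x * y ^ 2 + C d * y ^ 3) := by
  by_cases hd : d = 0
  · subst hd
    have hc : c ≠ 0 := by simpa using h
    obtain ⟨k, hk⟩ : ∃ k, k = b / (2 * c) := ⟨_, rfl⟩
    have hb : b = 2 * c * k := by rw [hk]; field_simp
    refine ⟨c * k ^ 2, c * k ^ 2, fun t ht _ => ?_⟩
    have key := isCubeSum_mul_sum_sq hx (hy.add (hx.C_mul k)) (c := c) (sub_ne_zero.2 ht)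
    convert key using 1
    rw [hb]
    simp only [map_sub, map_mul, map_pow, map_zero, map_ofNat]
    ring
  · obtain ⟨k, hk⟩ : ∃ k, k = c / (3 * d) := ⟨_, rfl⟩
    have hc : c = 3 * d * k := by rw [hk]; field_simp
    obtain ⟨m, hm⟩ : ∃ m, m = (b / d - 3 * k ^ 2) / 3 := ⟨_, rfl⟩
    have hb : b = d * (3 * m + 3 * k ^ 2) := by rw [hm]; field_simp; ring
    obtain ⟨w, hw⟩ := exists_square_root (- 4 * m ^ 3)
    refine ⟨d * (w + (k ^ 3 + 3 * m * k)), d * (- w + (k ^ 3 + 3 * m * k)), fun t ht ht' => ?_⟩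
    obtain ⟨e, he⟩ : ∃ e, e = t / d - (k ^ 3 + 3 * m * k) := ⟨_, rfl⟩
    have ht0 : t = d * (e + (k ^ 3 + 3 * m * k)) := by rw [he]; field_simp; ring
    have hne : e ^ 2 + 4 * m ^ 3 ≠ 0 := by
      intro h0
      have : (e - w) * (e + w) = 0 := by linear_combination h0 - hw
      rcases mul_eq_zero.1 this with h1 | h1
      · exact ht (by rw [ht0, sub_eq_zero.1 h1])
      · exact ht' (by rw [ht0, eq_neg_of_add_eq_zero_left h1])
    have key := (isCubeSum_depressed hx (hy.add (hx.C_mul k)) hne).C_mul d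
    convert key using 1
    rw [hb, hc, ht0]
    simp only [map_add, map_mul, map_pow, map_ofNat]
    ring

lemma isCubeSum_binary {x y : Ternary} (hx : IsLinearForm x) (hy : IsLinearForm y)
    (a b c d : ℂ) :
    IsCubeSum 3 (C a * x ^ 3 + C b * x ^ 2 * y + C c * x * y ^ 2 + C d * y ^ 3) := by
  by_cases h : c ≠ 0 ∨ d ≠ 0
  · obtain ⟨r, s, hrs⟩ := exists_isCubeSum_two hx hy b c d h
    obtain ⟨t, ht⟩ := Infinite.exists_notMem_finset ({r, s} : Finset ℂ)
    simp only [Finset.mem_insert, Finset.mem_singleton, not_or] at ht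
    convert (hrs t ht.1 ht.2).add (hx.isCubeSum.C_mul (a - t)) using 1
    rw [C_sub]; ring
  · push Not at h
    obtain ⟨rfl, rfl⟩ := h
    convert isCubeSum_sq_mul hx ((hx.C_mul a).add (hy.C_mul b)) using 1
    simp only [map_zero]; ring

/-- Being a sum of four cubes, or of the shape `x (x y + z²)`. -/
def IsFourOrTangent (f : Ternary) : Prop :=
  IsCubeSum 4 f ∨ ∃ x y z : Ternary, IsLinearForm x ∧ IsLinearForm y ∧ IsLinearForm z ∧
    f = x * (x * y + z ^ 2)

lemma isFourOrTangent_sq_mul_add {x y z : Ternary} (hx : IsLinearForm x) (hy : IsLinearForm y)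
    (hz : IsLinearForm z) (c d : ℂ) :
    IsFourOrTangent (x ^ 2 * y + C c * x * z ^ 2 + C d * z ^ 3) := by
  by_cases hd : d = 0
  · subst hd
    obtain ⟨s, rfl⟩ := exists_square_root c
    exact Or.inr ⟨x, y, C s * z, hx, hy, hz.C_mul s, by simp only [map_pow, map_zero]; ring⟩
  · left
    obtain ⟨k, hk⟩ : ∃ k, k = c / (3 * d) := ⟨_, rfl⟩
    have hc : c = 3 * d * k := by rw [hk]; field_simp
    convert ((hz.add (hx.C_mul k)).isCubeSum.C_mul d).add
      (isCubeSum_sq_mul hx ((hy.sub (hx.C_mul (d * k ^ 3))).sub (hz.C_mul (3 * d * k ^ 2))))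
      using 1
    rw [hc]
    simp only [map_mul, map_pow, map_ofNat]
    ring

/-- The case of a sum of two binary cubics sharing a variable. -/
lemma isFourOrTangent_binary_add_binary {x y z : Ternary} (hx : IsLinearForm x)
    (hy : IsLinearForm y) (hz : IsLinearForm z) (a b c d b' c' d' : ℂ) :
    IsFourOrTangent (C a * x ^ 3 + C b * x ^ 2 * y + C c * x * y ^ 2 + C d * y ^ 3
      + C b' * x ^ 2 * z + C c' * x * z ^ 2 + C d' * z ^ 3) := by
  by_cases h : c ≠ 0 ∨ d ≠ 0
  · by_cases h' : c' ≠ 0 ∨ d' ≠ 0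
    · obtain ⟨r, s, hrs⟩ := exists_isCubeSum_two hx hy b c d h
      obtain ⟨r', s', hrs'⟩ := exists_isCubeSum_two hx hz b' c' d' h'
      obtain ⟨t, ht⟩ := Infinite.exists_notMem_finset ({r, s, a - r', a - s'} : Finset ℂ)
      simp only [Finset.mem_insert, Finset.mem_singleton, not_or] at ht
      obtain ⟨h1, h2, h3, h4⟩ := ht
      left
      convert (hrs t h1 h2).add (hrs' (a - t) (fun h => h3 (by rw [← h]; ring))
        (fun h => h4 (by rw [← h]; ring))) using 1
      rw [C_sub]; ring
    · push Not at h'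
      obtain ⟨rfl, rfl⟩ := h'
      convert isFourOrTangent_sq_mul_add hx (((hx.C_mul a).add (hy.C_mul b)).add (hz.C_mul b'))
        hy c d using 1
      simp only [map_zero]; ring
  · push Not at h
    obtain ⟨rfl, rfl⟩ := h
    convert isFourOrTangent_sq_mul_add hx (((hx.C_mul a).add (hy.C_mul b)).add (hz.C_mul b'))
      hz c' d' using 1
    simp only [map_zero]; ring

lemma isFourOrTangent_mul_mul_add {x y z : Ternary} (hx : IsLinearForm x)
    (hy : IsLinearForm y) (hz : IsLinearForm z) (e a b c d : ℂ) :
    IsFourOrTangent (C e * z * x * y + C a * x ^ 3 + C b * x ^ 2 * y + C c * x * y ^ 2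
      + C d * y ^ 3) := by
  obtain ⟨w, hw⟩ : ∃ w, w = C e * z + C b * x + C c * y := ⟨_, rfl⟩
  have hwl : IsLinearForm w := hw ▸ ((hz.C_mul e).add (hx.C_mul b)).add (hy.C_mul c)
  obtain ⟨p, hp⟩ : ∃ p, p = C (1 / 2) * (x + y) := ⟨_, rfl⟩
  obtain ⟨q, hq⟩ : ∃ q, q = C (1 / 2) * (x - y) := ⟨_, rfl⟩
  have hpl : IsLinearForm p := hp ▸ (hx.add hy).C_mul _
  have hql : IsLinearForm q := hq ▸ (hx.sub hy).C_mul _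
  have h2 : (2 : Ternary) * C (1 / 2) = 1 := by
    rw [show (2 : Ternary) = C 2 from (map_ofNat C 2).symm, ← C_mul]; norm_num
  have hxe : x = p + q := by rw [hp, hq]; linear_combination -x * h2
  have hye : y = p - q := by rw [hp, hq]; linear_combination -y * h2
  obtain ⟨r, hr⟩ : ∃ r, r = w - C (3 * (a + d)) * p + C (3 * (a - d)) * q := ⟨_, rfl⟩
  have hrl : IsLinearForm r := hr ▸ (hwl.sub (hpl.C_mul _)).add (hql.C_mul _)
  convert isFourOrTangent_binary_add_binary hrl hpl hql 0 0 1 (4 * (a + d)) 0 (-1) (4 * (a - d))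
    using 1
  have : C e * z * x * y + C a * x ^ 3 + C b * x ^ 2 * y + C c * x * y ^ 2
      + C d * y ^ 3 = w * x * y + C a * x ^ 3 + C d * y ^ 3 := by rw [hw]; ring
  rw [this, hr, hxe, hye]
  simp only [map_zero, map_one, map_neg, map_mul, map_add, map_sub, map_ofNat]
  ring

lemma eq_C_of_isHomogeneous_zero {f : Ternary} (hf : f.IsHomogeneous 0) :
    f = C (coeff 0 f) :=
  totalDegree_eq_zero_iff_eq_C.1 ((totalDegree_zero_iff_isHomogeneous _).2 hf)

lemma eq_sum_X_mul_pderiv {f : Ternary} {n : ℕ} (hf : f.IsHomogeneous (n + 1)) :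
    f = C ((n + 1 : ℂ)⁻¹) * ∑ i, X i * pderiv i f := by
  have h := hf.sum_X_mul_pderiv
  rw [h, nsmul_eq_mul, ← mul_assoc, show ((n + 1 : ℕ) : Ternary) = C (n + 1 : ℂ) by simp,
    ← C_mul, inv_mul_cancel₀ (by exact_mod_cast Nat.succ_ne_zero n), C_1, one_mul]

lemma pderiv_pderiv_comm (i j : Fin 3) (f : Ternary) :
    pderiv i (pderiv j f) = pderiv j (pderiv i f) := by
  have h : ⁅(pderiv i : Derivation ℂ Ternary Ternary),
      (pderiv j : Derivation ℂ Ternary Ternary)⁆ = 0 := by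
    apply MvPolynomial.derivation_ext
    intro k
    rw [Derivation.commutator_apply]
    simp [pderiv_X, Pi.single_apply, apply_ite]
  have := congrArg (fun D => D f) h
  simpa [Derivation.commutator_apply, sub_eq_zero] using this

/-- A ternary cubic form is the restriction to the diagonal of a symmetric trilinear form. -/
lemma exists_symm_tensor {f : Ternary} (hf : f.IsHomogeneous 3) :
    ∃ T : Fin 3 → Fin 3 → Fin 3 → ℂ, (∀ i j k, T i j k = T j i k) ∧
      (∀ i j k, T i j k = T i k j) ∧
      f = ∑ i, X i * ∑ j, X j * ∑ k, X k * C (T i j k) := by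
  refine ⟨fun i j k => 6⁻¹ * coeff 0 (pderiv k (pderiv j (pderiv i f))), fun i j k => ?_,
    fun i j k => ?_, ?_⟩
  · dsimp only
    rw [pderiv_pderiv_comm i j]
  · dsimp only
    rw [pderiv_pderiv_comm k j]
  · have h3 : ∀ i j k, pderiv k (pderiv j (pderiv i f)) =
        C (coeff 0 (pderiv k (pderiv j (pderiv i f)))) := fun i j k =>
      eq_C_of_isHomogeneous_zero hf.pderiv.pderiv.pderiv
    have h2 : ∀ i j, pderiv j (pderiv i f) =
        ∑ k, X k * C (coeff 0 (pderiv k (pderiv j (pderiv i f)))) := fun i j => by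
      have := eq_sum_X_mul_pderiv (n := 0) (f := pderiv j (pderiv i f)) hf.pderiv.pderiv
      simp only [← h3]
      simpa using this
    have h1 : ∀ i, pderiv i f = C 2⁻¹ * ∑ j, X j * pderiv j (pderiv i f) := fun i => by
      convert eq_sum_X_mul_pderiv (n := 1) (f := pderiv i f) hf.pderiv using 3
      norm_num
    have h0 : f = C 3⁻¹ * ∑ i, X i * pderiv i f := by
      convert eq_sum_X_mul_pderiv (n := 2) hf using 3
      norm_num
    have h12 : ∀ i, pderiv i f = C 2⁻¹ * ∑ j, X j *
        ∑ k, X k * C (coeff 0 (pderiv k (pderiv j (pderiv i f)))) := fun i =>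
      (h1 i).trans (congrArg _ (Finset.sum_congr rfl fun j _ => congrArg _ (h2 i j)))
    refine h0.trans ((congrArg _ (Finset.sum_congr rfl fun i _ => congrArg _ (h12 i))).trans ?_)
    have h6 : (C 6⁻¹ : Ternary) = C 3⁻¹ * C 2⁻¹ := by rw [← C_mul]; norm_num
    simp only [C_mul, h6, Finset.mul_sum]
    refine Finset.sum_congr rfl fun i _ => Finset.sum_congr rfl fun j _ =>
      Finset.sum_congr rfl fun k _ => by ring

lemma sum_X_mul_eq (A : Matrix (Fin 3) (Fin 3) ℂ) (x y g : Fin 3 → Ternary)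
    (hx : ∀ i, x i = ∑ a, C (A i a) * y a) :
    ∑ i, x i * g i = ∑ a, y a * ∑ i, C (A i a) * g i := by
  simp only [hx, Fin.sum_univ_three]
  ring

/-- Change of coordinates for the trilinear form of a cubic. -/
lemma exists_tensor_basis {T : Fin 3 → Fin 3 → Fin 3 → ℂ} (hT₁ : ∀ i j k, T i j k = T j i k)
    (hT₂ : ∀ i j k, T i j k = T i k j) (v : Fin 3 → Fin 3 → ℂ) (hv : LinearIndependent ℂ v) :
    ∃ (S : Fin 3 → Fin 3 → Fin 3 → ℂ) (y : Fin 3 → Ternary), (∀ a, IsLinearForm (y a)) ∧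
      (∀ i j k, S i j k = S j i k) ∧ (∀ i j k, S i j k = S i k j) ∧
      (∀ a b, (∀ k, ∑ i, v a i * ∑ j, v b j * T i j k = 0) → ∀ c, S a b c = 0) ∧
      ∑ i, X i * ∑ j, X j * ∑ k, X k * C (T i j k) =
        ∑ a, y a * ∑ b, y b * ∑ c, y c * C (S a b c) := by
  obtain ⟨A, hA⟩ : ∃ A : Matrix (Fin 3) (Fin 3) ℂ, A = (Matrix.of v).transpose := ⟨_, rfl⟩
  have hAv : ∀ i a, A i a = v a i := fun i a => by rw [hA]; rfl
  have hu : IsUnit A := by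
    rw [hA, Matrix.isUnit_transpose]
    exact Matrix.linearIndependent_rows_iff_isUnit.1 hv
  have hinv : A * A⁻¹ = 1 := Matrix.mul_nonsing_inv _ ((Matrix.isUnit_iff_isUnit_det _).1 hu)
  obtain ⟨y, hy⟩ : ∃ y : Fin 3 → Ternary, y = fun a => ∑ j, C (A⁻¹ a j) * X j := ⟨_, rfl⟩
  have hX : ∀ i, (X i : Ternary) = ∑ a, C (A i a) * y a := by
    intro i
    have : ∀ j, ∑ a, A i a * A⁻¹ a j = if i = j then 1 else 0 := fun j => by
      rw [← Matrix.mul_apply, hinv, Matrix.one_apply]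
    simp only [hy, Finset.mul_sum]
    rw [Finset.sum_comm]
    simp only [← mul_assoc, ← Finset.sum_mul, ← C_mul, ← map_sum, this]
    simp
  refine ⟨fun a b c => ∑ i, A i a * ∑ j, A j b * ∑ k, A k c * T i j k, y, ?_, ?_, ?_, ?_, ?_⟩
  · intro a
    rw [hy]
    exact MvPolynomial.IsHomogeneous.sum _ _ _ fun j _ => isHomogeneous_C_mul_X _ _
  · intro a b c
    simp only [Finset.mul_sum]
    rw [Finset.sum_comm]
    refine Finset.sum_congr rfl fun i _ => Finset.sum_congr rfl fun j _ =>
      Finset.sum_congr rfl fun k _ => by rw [hT₁]; ring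
  · intro a b c
    simp only [Finset.mul_sum]
    refine Finset.sum_congr rfl fun i _ => ?_
    rw [Finset.sum_comm]
    refine Finset.sum_congr rfl fun j _ =>
      Finset.sum_congr rfl fun k _ => by rw [hT₂]; ring
  · intro a b h c
    have : ∑ k, A k c * ∑ i, v a i * ∑ j, v b j * T i j k = 0 := by simp [h]
    rw [← this]
    simp only [hAv, Fin.sum_univ_three]
    ring
  · rw [sum_X_mul_eq A _ y _ hX]
    refine Finset.sum_congr rfl fun a _ => congrArg _ ?_
    have h1 : ∀ i, ∑ j, (X j : Ternary) * ∑ k, X k * C (T i j k) =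
        ∑ b, y b * ∑ c, y c * ∑ j, C (A j b) * ∑ k, C (A k c) * C (T i j k) := by
      intro i
      rw [sum_X_mul_eq A _ y _ hX]
      refine Finset.sum_congr rfl fun b _ => congrArg _ ?_
      simp only [sum_X_mul_eq A _ y _ hX, Fin.sum_univ_three]
      ring
    simp only [h1]
    simp only [map_sum, C_mul, Finset.mul_sum]
    rw [Finset.sum_comm]
    refine Finset.sum_congr rfl fun b _ => ?_
    rw [Finset.sum_comm]
    refine Finset.sum_congr rfl fun c _ => Finset.sum_congr rfl fun i _ =>
      Finset.sum_congr rfl fun j _ => Finset.sum_congr rfl fun k _ => by ring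

/-- The polar conic of some point is degenerate. -/
lemma exists_conjugate_pair (T : Fin 3 → Fin 3 → Fin 3 → ℂ)
    (hT : ∀ i j k, T i j k = T i k j) :
    ∃ p q : Fin 3 → ℂ, p ≠ 0 ∧ q ≠ 0 ∧ ∀ k, ∑ i, p i * ∑ j, q j * T i j k = 0 := by
  obtain ⟨M, hM⟩ : ∃ M : Fin 3 → Matrix (Fin 3) (Fin 3) ℂ, M = fun i => Matrix.of (T i) :=
    ⟨_, rfl⟩
  have hMT : ∀ i (q : Fin 3 → ℂ) k, (M i).mulVec q k = ∑ j, q j * T i j k := fun i q k => by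
    simp only [hM, Matrix.mulVec, dotProduct, Matrix.of_apply]
    exact Finset.sum_congr rfl fun j _ => by rw [hT, mul_comm]
  by_cases h0 : (M 0).det = 0
  · obtain ⟨q, hq, h⟩ := Matrix.exists_mulVec_eq_zero_iff.2 h0
    refine ⟨Pi.single 0 1, q, by simp, hq, fun k => ?_⟩
    simp [Pi.single_apply, ← hMT, h]
  · obtain ⟨t, ht⟩ := Module.End.exists_eigenvalue (Matrix.toLin' ((M 0)⁻¹ * M 1))
    obtain ⟨q, hq⟩ := ht.exists_hasEigenvector
    have h1 : (M 1).mulVec q = t • (M 0).mulVec q := by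
      have := congrArg (M 0).mulVec hq.apply_eq_smul
      rwa [Matrix.toLin'_apply, Matrix.mulVec_mulVec, ← mul_assoc,
        Matrix.mul_nonsing_inv _ (isUnit_iff_ne_zero.2 h0), one_mul, Matrix.mulVec_smul] at this
    refine ⟨![-t, 1, 0], q, fun h => by simpa using congrFun h 1, hq.2, fun k => ?_⟩
    have := congrFun h1 k
    simp only [Pi.smul_apply, smul_eq_mul, hMT] at this
    rw [Fin.sum_univ_three]
    simp only [Matrix.cons_val]
    linear_combination this

lemma exists_linearIndependent_cons {n : ℕ} (hn : n < 3) {v : Fin n → Fin 3 → ℂ}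
    (hv : LinearIndependent ℂ v) : ∃ x, LinearIndependent ℂ (Fin.cons x v : Fin (n + 1) → _) :=
  exists_linearIndependent_cons_of_lt_finrank hv (by simpa using hn)

/-- A cubic that is singular at a coordinate point. -/
lemma isFourOrTangent_of_singular {x y z : Ternary} (hx : IsLinearForm x)
    (hy : IsLinearForm y) (hz : IsLinearForm z) (e₁ e₂ e₃ a b c d : ℂ) :
    IsFourOrTangent (z * (C e₁ * x ^ 2 + C e₂ * x * y + C e₃ * y ^ 2) + C a * x ^ 3
      + C b * x ^ 2 * y + C c * x * y ^ 2 + C d * y ^ 3) := by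
  by_cases h₁ : e₁ = 0
  · subst h₁
    by_cases h₂ : e₂ = 0
    · subst h₂
      convert isFourOrTangent_binary_add_binary hy hx hz d c b a e₃ 0 0 using 1
      simp only [map_zero]; ring
    · obtain ⟨w, hw⟩ : ∃ w, w = x + C (e₃ / e₂) * y := ⟨_, rfl⟩
      have hx' : x = w - C (e₃ / e₂) * y := by rw [hw]; ring
      have hwl : IsLinearForm w := hw ▸ hx.add (hy.C_mul _)
      obtain ⟨k, hk⟩ : ∃ k, k = e₃ / e₂ := ⟨_, rfl⟩
      have he : e₃ = e₂ * k := by rw [hk]; field_simp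
      rw [← hk] at hx'
      convert isFourOrTangent_mul_mul_add hwl hy hz e₂ a (b - 3 * a * k)
        (c - 2 * b * k + 3 * a * k ^ 2) (d - c * k + b * k ^ 2 - a * k ^ 3) using 1
      rw [hx', he]
      simp only [map_zero, map_sub, map_add, map_mul, map_pow, map_ofNat]
      ring
  · obtain ⟨s, hs⟩ := exists_square_root ((e₂ / e₁) ^ 2 - 4 * (e₃ / e₁))
    obtain ⟨m, hm⟩ : ∃ m, m = (e₂ / e₁ + s) / 2 := ⟨_, rfl⟩
    have h₂ : e₂ = e₁ * (2 * m - s) := by rw [hm]; field_simp; ring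
    have h₃ : e₃ = e₁ * (m * (m - s)) := by
      have : e₃ / e₁ = m * (m - s) := by rw [hm]; linear_combination (1 / 4) * hs
      rw [← this]; field_simp
    obtain ⟨u, hu⟩ : ∃ u, u = x + C m * y := ⟨_, rfl⟩
    have hul : IsLinearForm u := hu ▸ hx.add (hy.C_mul _)
    have hx' : x = u - C m * y := by rw [hu]; ring
    by_cases hs0 : s = 0
    · subst hs0
      convert isFourOrTangent_binary_add_binary hul hy hz a (b - 3 * a * m)
        (c - 2 * b * m + 3 * a * m ^ 2) (d - c * m + b * m ^ 2 - a * m ^ 3) e₁ 0 0 using 1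
      rw [hx', h₂, h₃]
      simp only [map_zero, map_sub, map_add, map_mul, map_pow, map_ofNat]
      ring
    · obtain ⟨v, hv⟩ : ∃ v, v = x + C (m - s) * y := ⟨_, rfl⟩
      have hvl : IsLinearForm v := hv ▸ hx.add (hy.C_mul _)
      obtain ⟨r, hr⟩ : ∃ r, r = s⁻¹ := ⟨_, rfl⟩
      have hrs : (C r * C s : Ternary) = 1 := by
        rw [← C_mul, hr, inv_mul_cancel₀ hs0, C_1]
      have hy' : y = C r * u - C r * v := by
        rw [hu, hv, C_sub]; linear_combination (-y) * hrs
      obtain ⟨k, hk⟩ : ∃ k, k = 1 - m * r := ⟨_, rfl⟩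
      obtain ⟨l, hl⟩ : ∃ l, l = m * r := ⟨_, rfl⟩
      have hx'' : x = C k * u + C l * v := by
        rw [hx', hy', hk, hl]; simp only [map_sub, map_mul, map_one]; ring
      have hq : C e₁ * x ^ 2 + C e₂ * x * y + C e₃ * y ^ 2 = C e₁ * u * v := by
        rw [hu, hv, h₂, h₃]; simp only [map_sub, map_mul, map_ofNat]; ring
      convert isFourOrTangent_mul_mul_add hul hvl hz e₁
        (a * k ^ 3 + b * k ^ 2 * r + c * k * r ^ 2 + d * r ^ 3)
        (3 * a * k ^ 2 * l + b * (2 * k * l * r - k ^ 2 * r) + c * (l * r ^ 2 - 2 * k * r ^ 2)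
          - 3 * d * r ^ 3)
        (3 * a * k * l ^ 2 + b * (l ^ 2 * r - 2 * k * l * r) + c * (k * r ^ 2 - 2 * l * r ^ 2)
          + 3 * d * r ^ 3)
        (a * l ^ 3 - b * l ^ 2 * r + c * l * r ^ 2 - d * r ^ 3) using 1
      rw [hq, hx'', hy']
      simp only [map_sub, map_add, map_mul, map_pow, map_ofNat]
      ring

lemma symm_tensor_sum {S : Fin 3 → Fin 3 → Fin 3 → ℂ} (hS₁ : ∀ i j k, S i j k = S j i k)
    (hS₂ : ∀ i j k, S i j k = S i k j) (y : Fin 3 → Ternary) :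
    ∑ a, y a * ∑ b, y b * ∑ c, y c * C (S a b c) =
      C (S 0 0 0) * y 0 ^ 3 + C (S 1 1 1) * y 1 ^ 3 + C (S 2 2 2) * y 2 ^ 3
      + 3 * (C (S 0 0 1) * y 0 ^ 2 * y 1 + C (S 0 0 2) * y 0 ^ 2 * y 2
        + C (S 1 1 0) * y 1 ^ 2 * y 0 + C (S 1 1 2) * y 1 ^ 2 * y 2
        + C (S 2 2 0) * y 2 ^ 2 * y 0 + C (S 2 2 1) * y 2 ^ 2 * y 1)
      + 6 * (C (S 1 2 0) * y 0 * y 1 * y 2) := by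
  have h (i j : Fin 3) : S i j i = S i i j := hS₂ i j i
  have h' (i j : Fin 3) : S j i i = S i i j := (hS₁ j i i).trans (hS₂ i j i)
  simp only [Fin.sum_univ_three]
  rw [h 0 1, h' 0 1, h 0 2, h' 0 2, h 1 0, h' 1 0, h 1 2, h' 1 2, h 2 0, h' 2 0, h 2 1, h' 2 1,
    hS₂ 0 2 1, hS₁ 0 1 2, hS₂ 1 0 2, hS₁ 2 0 1, hS₂ 0 2 1, hS₁ 0 1 2, hS₂ 1 0 2, hS₁ 2 1 0]
  ring

theorem isFourOrTangent_of_isHomogeneous {f : Ternary} (hf : f.IsHomogeneous 3) :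
    IsFourOrTangent f := by
  obtain ⟨T, hT₁, hT₂, rfl⟩ := exists_symm_tensor hf
  obtain ⟨p, q, hp, hq, h⟩ := exists_conjugate_pair T hT₂
  by_cases hpq : LinearIndependent ℂ ![p, q]
  · obtain ⟨r, hr⟩ := exists_linearIndependent_cons (by norm_num) hpq
    obtain ⟨S, y, hy, hS₁, hS₂, hS, he⟩ := exists_tensor_basis hT₁ hT₂ _ hr
    have h0 := hS 1 2 h
    rw [he]
    convert isFourOrTangent_binary_add_binary (hy 0) (hy 1) (hy 2) (S 0 0 0) (3 * S 0 0 1)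
      (3 * S 0 1 1) (S 1 1 1) (3 * S 0 0 2) (3 * S 0 2 2) (S 2 2 2) using 1
    rw [symm_tensor_sum hS₁ hS₂, hS₂ 1 1 2, hS₂ 2 2 1, hS₁ 2 1 2]
    simp only [h0, hS₂ 1 1 0, hS₁ 1 0 1, hS₂ 2 2 0, hS₁ 2 0 2, map_mul, map_ofNat, map_zero]
    ring
  · rw [LinearIndependent.pair_iff' hp] at hpq
    push Not at hpq
    obtain ⟨t, rfl⟩ := hpq
    have ht : t ≠ 0 := by rintro rfl; simp at hq
    have h' : ∀ k, ∑ i, p i * ∑ j, p j * T i j k = 0 := fun k => by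
      have := h k
      simp only [Pi.smul_apply, smul_eq_mul, mul_assoc, ← Finset.mul_sum,
        mul_left_comm _ t] at this
      simpa [ht] using this
    have hp1 : LinearIndependent ℂ ![p] := LinearIndependent.of_subsingleton 0 hp
    obtain ⟨r, hr⟩ := exists_linearIndependent_cons (by norm_num) hp1
    obtain ⟨s, hs⟩ := exists_linearIndependent_cons (by norm_num) hr
    obtain ⟨S, y, hy, hS₁, hS₂, hS, he⟩ := exists_tensor_basis hT₁ hT₂ _ hs
    have h0 := hS 2 2 h'
    rw [he]
    convert isFourOrTangent_of_singular (hy 0) (hy 1) (hy 2) (3 * S 0 0 2) (6 * S 1 2 0)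
      (3 * S 1 1 2) (S 0 0 0) (3 * S 0 0 1) (3 * S 1 1 0) (S 1 1 1) using 1
    rw [symm_tensor_sum hS₁ hS₂]
    simp only [h0, map_mul, map_ofNat, map_zero]
    ring

/-- The coefficient identities that express `x (x z + y²)` as a sum of four cubes of the linear
forms `pₖ x + qₖ y + rₖ z` are contradictory. -/
lemma tangent_coeffs_absurd (p q r : Fin 4 → ℂ)
    (h₁ : ∑ k, p k ^ 2 * r k = 1 / 3) (h₂ : ∑ k, p k * q k ^ 2 = 1 / 3)
    (h₃ : ∑ k, p k ^ 2 * q k = 0) (h₄ : ∑ k, p k * q k * r k = 0)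
    (h₅ : ∑ k, p k * r k ^ 2 = 0) (h₆ : ∑ k, q k ^ 3 = 0) (h₇ : ∑ k, q k ^ 2 * r k = 0)
    (h₈ : ∑ k, q k * r k ^ 2 = 0) (h₉ : ∑ k, r k ^ 3 = 0) : False := by
  obtain ⟨N, hN⟩ : ∃ N : Matrix (Fin 3) (Fin 4) ℂ, N = Matrix.of ![p, q, r] := ⟨_, rfl⟩
  have hNv : ∀ v : Fin 4 → ℂ, Matrix.toLin' N v =
      ![∑ k, p k * v k, ∑ k, q k * v k, ∑ k, r k * v k] := fun v => by
    ext i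
    fin_cases i <;> simp [hN, Matrix.mulVec, dotProduct]
  have hsurj : LinearMap.range (Matrix.toLin' N) = ⊤ := by
    rw [LinearMap.range_eq_top]
    intro b
    refine ⟨fun k => 3 * (b 0 * (p k * r k) + b 1 * (p k * q k)
      + (b 2) * (p k ^ 2)) - 9 * (∑ k, p k ^ 3) * b 2 * (p k * r k), ?_⟩
    rw [hNv]
    simp only [Fin.sum_univ_four] at *
    ext i
    fin_cases i
    · simp only [Fin.zero_eta, Matrix.cons_val]
      linear_combination (3 * b 0 - 9 * (p 0 ^ 3 + p 1 ^ 3 + p 2 ^ 3 + p 3 ^ 3) * b 2) * h₁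
        + 3 * b 1 * h₃
    · simp only [Fin.mk_one, Matrix.cons_val]
      linear_combination (3 * b 0 - 9 * (p 0 ^ 3 + p 1 ^ 3 + p 2 ^ 3 + p 3 ^ 3) * b 2) * h₄
        + 3 * b 1 * h₂ + 3 * b 2 * h₃
    · simp only [Fin.reduceFinMk, Matrix.cons_val]
      linear_combination (3 * b 0 - 9 * (p 0 ^ 3 + p 1 ^ 3 + p 2 ^ 3 + p 3 ^ 3) * b 2) * h₅
        + 3 * b 1 * h₄ + 3 * b 2 * h₁
  have hker : Module.finrank ℂ (LinearMap.ker (Matrix.toLin' N)) = 1 := by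
    have := LinearMap.finrank_range_add_finrank_ker (Matrix.toLin' N)
    rw [hsurj, finrank_top] at this
    simp at this
    omega
  have hr : (fun k => r k ^ 2) ≠ 0 := by
    intro h
    have hr0 : ∀ k, r k = 0 := fun k => by simpa using congrFun h k
    simp [hr0] at h₁
  have mem : ∀ v : Fin 4 → ℂ, ∑ k, p k * v k = 0 → ∑ k, q k * v k = 0 → ∑ k, r k * v k = 0 →
      v ∈ LinearMap.ker (Matrix.toLin' N) := fun v ha hb hc => by
    rw [LinearMap.mem_ker, hNv, ha, hb, hc]
    simp
  have m₁ : (fun k => r k ^ 2) ∈ LinearMap.ker (Matrix.toLin' N) := by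
    apply mem <;> simp only [Fin.sum_univ_four] at * <;> grind
  have m₂ : (fun k => q k * r k) ∈ LinearMap.ker (Matrix.toLin' N) := by
    apply mem <;> simp only [Fin.sum_univ_four] at * <;> grind
  have m₃ : (fun k => q k ^ 2 - p k * r k) ∈ LinearMap.ker (Matrix.toLin' N) := by
    apply mem <;> simp only [Fin.sum_univ_four] at * <;> grind
  have key := (finrank_eq_one_iff_of_nonzero' (⟨_, m₁⟩ : LinearMap.ker (Matrix.toLin' N))
    (by simpa using hr)).1 hker
  obtain ⟨s, hs⟩ := key ⟨_, m₂⟩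
  obtain ⟨t, ht⟩ := key ⟨_, m₃⟩
  have hs' : ∀ k, s * r k ^ 2 = q k * r k := fun k => congrFun (congrArg Subtype.val hs) k
  have ht' : ∀ k, t * r k ^ 2 = q k ^ 2 - p k * r k :=
    fun k => congrFun (congrArg Subtype.val ht) k
  have hq : ∀ k, q k = s * r k := fun k => by
    by_cases hk : r k = 0
    · have := ht' k
      simp only [hk] at this ⊢
      simpa using this.symm
    · apply mul_right_cancel₀ hk
      rw [← hs']; ring
  have : ∑ k, p k * q k ^ 2 = s * ∑ k, p k * q k * r k := by
    rw [Finset.mul_sum]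
    refine Finset.sum_congr rfl fun k _ => ?_
    rw [hq k]; ring
  rw [h₂, h₄] at this
  norm_num at this

lemma IsLinearForm.eq_sum {a : Ternary} (ha : IsLinearForm a) :
    ∃ c : Fin 3 → ℂ, a = ∑ j, C (c j) * X j := by
  refine ⟨fun j => coeff 0 (pderiv j a), ?_⟩
  have h : ∀ j, pderiv j a = C (coeff 0 (pderiv j a)) := fun j =>
    eq_C_of_isHomogeneous_zero (IsHomogeneous.pderiv ha)
  have := eq_sum_X_mul_pderiv (n := 0) ha
  simp only [← h]
  simpa [mul_comm] using this

lemma IsLinearForm.eval_add {a : Ternary} (ha : IsLinearForm a) (u v : Fin 3 → ℂ) :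
    eval (u + v) a = eval u a + eval v a := by
  obtain ⟨c, rfl⟩ := ha.eq_sum
  simp [Fin.sum_univ_three]; ring

lemma IsLinearForm.eval_smul {a : Ternary} (ha : IsLinearForm a) (t : ℂ) (v : Fin 3 → ℂ) :
    eval (t • v) a = t * eval v a := by
  obtain ⟨c, rfl⟩ := ha.eq_sum
  simp [Fin.sum_univ_three]; ring

lemma exists_dual_points {l : Fin 3 → Ternary} (hl : ∀ i, IsLinearForm (l i))
    (h : LinearIndependent ℂ l) :
    ∃ v : Fin 3 → Fin 3 → ℂ, ∀ i j, eval (v j) (l i) = if i = j then 1 else 0 := by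
  choose c hc using fun i => (hl i).eq_sum
  have hu : IsUnit (Matrix.of c) := by
    rw [← Matrix.linearIndependent_rows_iff_isUnit]
    apply LinearIndependent.of_comp (Fintype.linearCombination ℂ (fun j : Fin 3 => (X j : Ternary)))
    convert h using 1
    ext1 i
    rw [hc i]
    simp [Fintype.linearCombination_apply, smul_eq_C_mul]
  have hinv := Matrix.mul_nonsing_inv _ ((Matrix.isUnit_iff_isUnit_det _).1 hu)
  refine ⟨fun j k => (Matrix.of c)⁻¹ k j, fun i j => ?_⟩
  rw [← Matrix.one_apply, ← hinv, Matrix.mul_apply, hc i]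
  simp

/-- The cubic of an irreducible conic and a tangent line is not a sum of four cubes. -/
lemma not_isCubeSum_four_tangent {a b c : Ternary} (ha : IsLinearForm a) (hb : IsLinearForm b)
    (hc : IsLinearForm c) (h : LinearIndependent ℂ ![a, b, c]) :
    ¬ IsCubeSum 4 (a * (a * c + b ^ 2)) := by
  rintro ⟨l, hl, he⟩
  obtain ⟨v, hv⟩ := exists_dual_points (l := ![a, b, c])
    (by intro i; fin_cases i <;> assumption) h
  have key : ∀ x y z : ℂ, x * (x * z + y ^ 2) =
      ∑ k, (x * eval (v 0) (l k) + y * eval (v 1) (l k) + z * eval (v 2) (l k)) ^ 3 := by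
    intro x y z
    have := congrArg (eval (x • v 0 + y • v 1 + z • v 2)) he
    simp only [map_mul, map_add, map_pow, map_sum, ha.eval_add, hb.eval_add, hc.eval_add,
      ha.eval_smul, hb.eval_smul, hc.eval_smul, (hl _).eval_add, (hl _).eval_smul] at this
    rw [← this]
    have e : ∀ i j, eval (v j) ((![a, b, c] : Fin 3 → Ternary) i) = if i = j then 1 else 0 := hv
    have a0 := e 0 0
    have a1 := e 0 1
    have a2 := e 0 2
    have b0 := e 1 0
    have b1 := e 1 1
    have b2 := e 1 2
    have c0 := e 2 0
    have c1 := e 2 1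
    have c2 := e 2 2
    simp at a0 a1 a2 b0 b1 b2 c0 c1 c2
    rw [a0, a1, a2, b0, b1, b2, c0, c1, c2]
    ring
  simp only [Fin.sum_univ_four] at key
  have k1 := key 1 0 0
  have k2 := key 0 1 0
  have k3 := key 0 0 1
  have k4 := key 1 1 0
  have k5 := key 1 (-1) 0
  have k6 := key 1 0 1
  have k7 := key 1 0 (-1)
  have k8 := key 0 1 1
  have k9 := key 0 1 (-1)
  have k10 := key 1 1 1
  refine tangent_coeffs_absurd (fun k => eval (v 0) (l k)) (fun k => eval (v 1) (l k))
    (fun k => eval (v 2) (l k)) ?_ ?_ ?_ ?_ ?_ ?_ ?_ ?_ ?_ <;>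
    simp only [Fin.sum_univ_four] <;> clear key
  · linear_combination (-1 / 6) * (k6 - k7) + (1 / 3) * k3
  · linear_combination (-1 / 6) * (k4 + k5) + (1 / 3) * k1
  · linear_combination (-1 / 6) * (k4 - k5) + (1 / 3) * k2
  · linear_combination (-1 / 6) * (k10 - k4 - k6 - k8 + k1 + k2 + k3)
  · linear_combination (-1 / 6) * (k6 + k7) + (1 / 3) * k1
  · linear_combination -k2
  · linear_combination (-1 / 6) * (k8 - k9) + (1 / 3) * k3
  · linear_combination (-1 / 6) * (k8 + k9) + (1 / 3) * k2
  · linear_combination -k3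

/-- If the three linear forms are dependent, the cubic is binary. -/
lemma isCubeSum_of_not_linearIndependent {a b c : Ternary} (ha : IsLinearForm a)
    (hb : IsLinearForm b) (hc : IsLinearForm c) (h : ¬ LinearIndependent ℂ ![a, b, c]) :
    IsCubeSum 3 (a * (a * c + b ^ 2)) := by
  rw [Fintype.not_linearIndependent_iff] at h
  obtain ⟨g, hg, i, hi⟩ := h
  simp only [Fin.sum_univ_three, smul_eq_C_mul, Matrix.cons_val] at hg
  have hinv : (C (g i)⁻¹ * C (g i) : Ternary) = 1 := by
    rw [← C_mul, inv_mul_cancel₀ hi, C_1]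
  obtain ⟨t, ht⟩ : ∃ t, t = (g i)⁻¹ := ⟨_, rfl⟩
  rw [← ht] at hinv
  fin_cases i <;> simp only [Fin.zero_eta, Fin.mk_one, Fin.reduceFinMk] at hinv
  · obtain ⟨m, hm⟩ : ∃ m, m = - t * g 1 := ⟨_, rfl⟩
    obtain ⟨n, hn⟩ : ∃ n, n = - t * g 2 := ⟨_, rfl⟩
    have : a = C m * b + C n * c := by
      rw [hm, hn]; simp only [map_mul, map_neg]
      linear_combination C t * hg - a * hinv
    convert isCubeSum_binary hb hc m (m ^ 2 + n) (2 * m * n) (n ^ 2) using 1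
    rw [this]; simp only [map_mul, map_add, map_pow, map_ofNat]; ring
  · obtain ⟨m, hm⟩ : ∃ m, m = - t * g 0 := ⟨_, rfl⟩
    obtain ⟨n, hn⟩ : ∃ n, n = - t * g 2 := ⟨_, rfl⟩
    have : b = C m * a + C n * c := by
      rw [hm, hn]; simp only [map_mul, map_neg]
      linear_combination C t * hg - b * hinv
    convert isCubeSum_binary ha hc (m ^ 2) (1 + 2 * m * n) (n ^ 2) 0 using 1
    rw [this]; simp only [map_mul, map_add, map_pow, map_ofNat, map_one, map_zero]; ring
  · obtain ⟨m, hm⟩ : ∃ m, m = - t * g 0 := ⟨_, rfl⟩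
    obtain ⟨n, hn⟩ : ∃ n, n = - t * g 1 := ⟨_, rfl⟩
    have : c = C m * a + C n * b := by
      rw [hm, hn]; simp only [map_mul, map_neg]
      linear_combination C t * hg - c * hinv
    convert isCubeSum_binary ha hb m n 1 0 using 1
    rw [this]; simp only [map_one, map_zero]; ring

lemma isCubeSum_five_tangent {a b c : Ternary} (ha : IsLinearForm a) (hb : IsLinearForm b)
    (hc : IsLinearForm c) : IsCubeSum 5 (a * (a * c + b ^ 2)) := by
  convert (isCubeSum_sq_mul ha (hc.sub ha)).add
    (isCubeSum_mul_sum_sq ha hb (c := 1) (e := 1) one_ne_zero) using 1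
  simp only [map_one]; ring

lemma waringRank_le_iff {n : ℕ} {f : Ternary} {m : ℕ} (hm : IsCubeSum m f) :
    waringRank 3 f ≤ n ↔ IsCubeSum n f :=
  ⟨fun h => IsCubeSum.mono (Nat.sInf_mem (s := {r | IsCubeSum r f}) ⟨m, hm⟩) h,
    fun h => Nat.sInf_le h⟩

/-- Every ternary cubic form has Waring rank at most 5, with equality exactly for
forms `a (a c + b²)` with `{a, b, c}` linearly independent. -/
theorem cubic_rank_le_five (f : Ternary) (hf : MvPolynomial.IsHomogeneous f 3) :
    waringRank 3 f ≤ 5 ∧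
    (waringRank 3 f = 5 ↔
      ∃ a b c : Ternary, IsLinearForm a ∧ IsLinearForm b ∧ IsLinearForm c ∧
        LinearIndependent ℂ ![a, b, c] ∧ f = a * (a * c + b ^ 2)) := by
  have h5 : IsCubeSum 5 f := by
    rcases isFourOrTangent_of_isHomogeneous hf with h | ⟨x, y, z, hx, hy, hz, rfl⟩
    · exact h.mono (by norm_num)
    · exact isCubeSum_five_tangent hx hz hy
  have hle : waringRank 3 f ≤ 5 := (waringRank_le_iff h5).2 h5
  refine ⟨hle, fun h => ?_, ?_⟩
  · have h4 : ¬ IsCubeSum 4 f := fun h4 => by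
      have := (waringRank_le_iff h5).2 h4
      omega
    rcases isFourOrTangent_of_isHomogeneous hf with h' | ⟨x, y, z, hx, hy, hz, rfl⟩
    · exact absurd h' h4
    · refine ⟨x, z, y, hx, hz, hy, ?_, rfl⟩
      by_contra hli
      exact h4 ((isCubeSum_of_not_linearIndependent hx hz hy hli).mono (by norm_num))
  · rintro ⟨a, b, c, ha, hb, hc, hli, rfl⟩
    have h4 := not_isCubeSum_four_tangent ha hb hc hli
    rw [← waringRank_le_iff h5] at h4
    omega
end

section
/- If f = a³ + b³ + c³ for linear forms a, b, c over ℂ, then Hess(f) = 216·[abc]²·a·b·c. -/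
open MvPolynomial

/-- The partial derivative of a linear form is the corresponding coefficient. -/
theorem IsLinearForm.pderiv_eq_C {a : Ternary} (ha : IsLinearForm a) (i : Fin 3) :
    MvPolynomial.pderiv i a = MvPolynomial.C (MvPolynomial.coeff (Finsupp.single i 1) a) := by
  have h : (MvPolynomial.pderiv i a).IsHomogeneous 0 := MvPolynomial.IsHomogeneous.pderiv ha
  rw [← MvPolynomial.totalDegree_zero_iff_isHomogeneous,
    MvPolynomial.totalDegree_eq_zero_iff_eq_C] at h
  rw [h, MvPolynomial.coeff_pderiv]
  simp

/-- The second partial derivatives of the cube of a linear form. -/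
theorem IsLinearForm.pderiv_pderiv_cube {a : Ternary} (ha : IsLinearForm a) (i j : Fin 3) :
    MvPolynomial.pderiv i (MvPolynomial.pderiv j (a ^ 3)) =
      6 * a * MvPolynomial.C (MvPolynomial.coeff (Finsupp.single i 1) a) *
        MvPolynomial.C (MvPolynomial.coeff (Finsupp.single j 1) a) := by
  have h3 : a ^ 3 = a * (a * a) := by ring
  simp only [h3, Derivation.leibniz, map_add, smul_eq_mul, ha.pderiv_eq_C, MvPolynomial.pderiv_C]
  ring

/-- The Hessian of a sum of three cubes of linear forms. -/
theorem hess_sum_three_cubes (a b c : Ternary)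
    (ha : IsLinearForm a) (hb : IsLinearForm b) (hc : IsLinearForm c) :
    hess (a ^ 3 + b ^ 3 + c ^ 3) =
      MvPolynomial.C (216 * bracket a b c ^ 2) * (a * b * c) := by
  have h216 : (MvPolynomial.C 216 : Ternary) = 216 := map_ofNat MvPolynomial.C 216
  simp only [hess, bracket, Matrix.det_fin_three, Matrix.of_apply, map_add,
    ha.pderiv_pderiv_cube, hb.pderiv_pderiv_cube, hc.pderiv_pderiv_cube,
    Matrix.cons_val_zero, Matrix.cons_val_one, Matrix.cons_val, map_mul, map_pow, map_sub, h216]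
  ring
end

section
/- If f = a·(a·c + b²) for linear forms a, b, c over ℂ, then Hess(f) = −8·[abc]²·a³. -/
open MvPolynomial

/-- The partial derivative of a linear form is its corresponding coefficient. -/
theorem MvPolynomial.IsHomogeneous.pderiv_eq_C {σ R : Type*} [CommSemiring R]
    {p : MvPolynomial σ R} (hp : p.IsHomogeneous 1) (i : σ) :
    pderiv i p = C (coeff (Finsupp.single i 1) p) := by
  have h : (pderiv i p).IsHomogeneous 0 := hp.pderiv
  rw [totalDegree_eq_zero_iff_eq_C.mp (Nat.le_zero.mp h.totalDegree_le), coeff_pderiv]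
  simp

/-- The Hessian of `a (a c + b²)`. -/
theorem hess_conic_tangent (a b c : Ternary)
    (ha : IsLinearForm a) (hb : IsLinearForm b) (hc : IsLinearForm c) :
    hess (a * (a * c + b ^ 2)) =
      MvPolynomial.C (-8 * bracket a b c ^ 2) * a ^ 3 := by
  set M : Matrix (Fin 3) (Fin 3) Ternary :=
    Matrix.of ![fun i => C (coeff (Finsupp.single i 1) a),
      fun i => C (coeff (Finsupp.single i 1) b), fun i => C (coeff (Finsupp.single i 1) c)]
    with hM
  have hdet : M.det = C (bracket a b c) := by
    simp [hM, bracket, Matrix.det_fin_three]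
  have hmul : (Matrix.of fun i j : Fin 3 => pderiv i (pderiv j (a * (a * c + b ^ 2)))) =
      M.transpose * !![2 * c, 2 * b, 2 * a; 2 * b, 2 * a, 0; 2 * a, 0, 0] * M := by
    ext1 i j
    simp only [hM, Matrix.mul_apply, Fin.sum_univ_three, Matrix.of_apply, pderiv_mul, pow_two,
      map_add, IsHomogeneous.pderiv_eq_C ha, IsHomogeneous.pderiv_eq_C hb,
      IsHomogeneous.pderiv_eq_C hc, pderiv_C, Matrix.transpose_apply, Matrix.cons_val]
    ring
  rw [hess, hmul, Matrix.det_mul, Matrix.det_mul, Matrix.det_transpose, hdet,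
    Matrix.det_fin_three]
  have h8 : (C 8 : Ternary) = 8 := map_ofNat C 8
  simp [h8]
  ring
end

section
/- If f = a·b·c for linearly independent linear forms a, b, c over ℂ, then the Waring rank of the ternary cubic form f equals 4. -/
open MvPolynomial

/-- A linear form is a linear combination of the variables. -/
lemma IsLinearForm.exists_eq_sum {l : Ternary} (hl : IsLinearForm l) :
    ∃ k : Fin 3 → ℂ, l = ∑ j, k j • (X j : Ternary) := by
  have h : l ∈ homogeneousSubmodule (Fin 3) ℂ 1 := hl
  rw [homogeneousSubmodule_one_eq_span_X, Submodule.mem_span_range_iff_exists_fun] at h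
  obtain ⟨k, hk⟩ := h
  exact ⟨k, hk.symm⟩

/-- The function `(x, y, z) ↦ x * y * z` is not a sum of three cubes of linear functions. -/
lemma not_mul_eq_sum_three_cubes (p : Fin 3 → Fin 3 → ℂ)
    (h : ∀ w : Fin 3 → ℂ, w 0 * w 1 * w 2 = ∑ i, (p i ⬝ᵥ w) ^ 3) : False := by
  have key (x y z : ℂ) : x * y * z = (p 0 0 * x + p 0 1 * y + p 0 2 * z) ^ 3
      + (p 1 0 * x + p 1 1 * y + p 1 2 * z) ^ 3 + (p 2 0 * x + p 2 1 * y + p 2 2 * z) ^ 3 := by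
    simpa [Fin.sum_univ_three, dotProduct] using h ![x, y, z]
  have x3 := key 1 0 0
  have y3 := key 0 1 0
  have z3 := key 0 0 1
  have xy := key 1 1 0
  have xy' := key 1 (-1) 0
  have xz := key 1 0 1
  have xz' := key 1 0 (-1)
  have yz := key 0 1 1
  have yz' := key 0 1 (-1)
  have xyz := key 1 1 1
  have hxyz : p 0 0 * p 0 1 * p 0 2 + p 1 0 * p 1 1 * p 1 2 + p 2 0 * p 2 1 * p 2 2 = 1 / 6 := by
    linear_combination (-xyz + xy + xz + yz - x3 - y3 - z3) / 6
  have hxxy : p 0 0 ^ 2 * p 0 1 + p 1 0 ^ 2 * p 1 1 + p 2 0 ^ 2 * p 2 1 = 0 := by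
    linear_combination (-xy + xy' + 2 * y3) / 6
  have hxyy : p 0 0 * p 0 1 ^ 2 + p 1 0 * p 1 1 ^ 2 + p 2 0 * p 2 1 ^ 2 = 0 := by
    linear_combination (-xy - xy' + 2 * x3) / 6
  have hxxz : p 0 0 ^ 2 * p 0 2 + p 1 0 ^ 2 * p 1 2 + p 2 0 ^ 2 * p 2 2 = 0 := by
    linear_combination (-xz + xz' + 2 * z3) / 6
  have hxzz : p 0 0 * p 0 2 ^ 2 + p 1 0 * p 1 2 ^ 2 + p 2 0 * p 2 2 ^ 2 = 0 := by
    linear_combination (-xz - xz' + 2 * x3) / 6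
  have hyyz : p 0 1 ^ 2 * p 0 2 + p 1 1 ^ 2 * p 1 2 + p 2 1 ^ 2 * p 2 2 = 0 := by
    linear_combination (-yz + yz' + 2 * z3) / 6
  have hyzz : p 0 1 * p 0 2 ^ 2 + p 1 1 * p 1 2 ^ 2 + p 2 1 * p 2 2 ^ 2 = 0 := by
    linear_combination (-yz - yz' + 2 * y3) / 6
  by_cases hdet : (Matrix.of p).det = 0
  · obtain ⟨v, hv, hpv⟩ := Matrix.exists_mulVec_eq_zero_iff.mpr hdet
    have hrow (i : Fin 3) : p i 0 * v 0 + p i 1 * v 1 + p i 2 * v 2 = 0 := by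
      simpa [Matrix.mulVec, dotProduct, Fin.sum_univ_three] using congrFun hpv i
    apply hv
    ext i
    fin_cases i
    · simp only [Fin.zero_eta, Pi.zero_apply]
      linear_combination -6 * v 0 * hxyz - 6 * v 1 * hyyz - 6 * v 2 * hyzz
        + 6 * p 0 1 * p 0 2 * hrow 0 + 6 * p 1 1 * p 1 2 * hrow 1 + 6 * p 2 1 * p 2 2 * hrow 2
    · simp only [Fin.mk_one, Pi.zero_apply]
      linear_combination -6 * v 1 * hxyz - 6 * v 0 * hxxz - 6 * v 2 * hxzz
        + 6 * p 0 0 * p 0 2 * hrow 0 + 6 * p 1 0 * p 1 2 * hrow 1 + 6 * p 2 0 * p 2 2 * hrow 2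
    · simp only [Fin.reduceFinMk, Pi.zero_apply]
      linear_combination -6 * v 2 * hxyz - 6 * v 0 * hxxy - 6 * v 1 * hxyy
        + 6 * p 0 0 * p 0 1 * hrow 0 + 6 * p 1 0 * p 1 1 * hrow 1 + 6 * p 2 0 * p 2 1 * hrow 2
  · have hsq : (fun i => p i 0 ^ 2) = 0 := by
      refine Matrix.eq_zero_of_vecMul_eq_zero hdet ?_
      ext j
      fin_cases j
      · simp [Matrix.vecMul, dotProduct, Fin.sum_univ_three]
        linear_combination -x3
      · simpa [Matrix.vecMul, dotProduct, Fin.sum_univ_three] using hxxy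
      · simpa [Matrix.vecMul, dotProduct, Fin.sum_univ_three] using hxxz
    have hp (i : Fin 3) : p i 0 = 0 := by simpa using congrFun hsq i
    simp [hp] at hxyz

/-- Three linearly independent linear forms take arbitrary prescribed values, at points depending
linearly on the values. -/
lemma exists_matrix_eval_eq {f : Fin 3 → Ternary} (hf : ∀ i, IsLinearForm (f i))
    (hind : LinearIndependent ℂ f) :
    ∃ B : Matrix (Fin 3) (Fin 3) ℂ, ∀ w i, eval (B.mulVec w) (f i) = w i := by
  choose k hk using fun i => (hf i).exists_eq_sum
  have hdet : (Matrix.of k).det ≠ 0 := by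
    intro h
    obtain ⟨v, hv, hvk⟩ := Matrix.exists_vecMul_eq_zero_iff.mpr h
    refine hv (funext (Fintype.linearIndependent_iff.mp hind v ?_))
    calc ∑ i, v i • f i = ∑ i, v i • ∑ j, k i j • (X j : Ternary) := by simp_rw [← hk]
      _ = ∑ j, (Matrix.vecMul v (Matrix.of k)) j • (X j : Ternary) := by
        simp_rw [Finset.smul_sum, smul_smul, Matrix.vecMul, dotProduct, Finset.sum_smul]
        exact Finset.sum_comm
      _ = 0 := by simp [hvk]
  refine ⟨(Matrix.of k)⁻¹, fun w i => ?_⟩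
  have heval (v : Fin 3 → ℂ) : eval v (f i) = (Matrix.of k).mulVec v i := by
    rw [hk i]
    simp [Matrix.mulVec, dotProduct, smul_eval]
  rw [heval, Matrix.mulVec_mulVec, Matrix.mul_nonsing_inv _ (isUnit_iff_ne_zero.mpr hdet),
    Matrix.one_mulVec]

/-- A product of three linearly independent linear forms is not a sum of three cubes of linear
forms. -/
lemma mul_ne_sum_three_cubes {a b c : Ternary}
    (ha : IsLinearForm a) (hb : IsLinearForm b) (hc : IsLinearForm c)
    (hind : LinearIndependent ℂ ![a, b, c]) (l : Fin 3 → Ternary)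
    (hl : ∀ i, IsLinearForm (l i)) : a * b * c ≠ ∑ i, l i ^ 3 := by
  intro h
  obtain ⟨B, hB⟩ := exists_matrix_eval_eq (f := ![a, b, c])
    (by intro i; fin_cases i <;> assumption) hind
  choose k hk using fun i => (hl i).exists_eq_sum
  refine not_mul_eq_sum_three_cubes (fun i => Matrix.vecMul (k i) B) fun w => ?_
  have hw := congrArg (eval (B.mulVec w)) h
  have h0 : eval (B.mulVec w) a = w 0 := hB w 0
  have h1 : eval (B.mulVec w) b = w 1 := hB w 1
  have h2 : eval (B.mulVec w) c = w 2 := hB w 2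
  have hli (i : Fin 3) : eval (B.mulVec w) (l i) = Matrix.vecMul (k i) B ⬝ᵥ w := by
    rw [← Matrix.dotProduct_mulVec, hk i]
    simp [dotProduct, smul_eval]
  simpa only [map_mul, map_sum, map_pow, h0, h1, h2, hli] using hw

/-- A product of three linear forms is a sum of four cubes of linear forms. -/
lemma exists_mul_eq_sum_four_cubes {a b c : Ternary}
    (ha : IsLinearForm a) (hb : IsLinearForm b) (hc : IsLinearForm c) :
    ∃ l : Fin 4 → Ternary, (∀ i, IsLinearForm (l i)) ∧ a * b * c = ∑ i, l i ^ 3 := by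
  obtain ⟨t, ht⟩ := IsAlgClosed.exists_pow_nat_eq (1 / 24 : ℂ) (n := 3) (by norm_num)
  refine ⟨![C t * (a + b + c), C t * (c - a - b), C t * (b - a - c), C t * (a - b - c)], ?_, ?_⟩
  · intro i
    fin_cases i
    · exact ((ha.add hb).add hc).C_mul t
    · exact ((hc.sub ha).sub hb).C_mul t
    · exact ((hb.sub ha).sub hc).C_mul t
    · exact ((ha.sub hb).sub hc).C_mul t
  · have hC : (24 : Ternary) * C t ^ 3 = 1 := by
      rw [← C_pow, ht, ← map_ofNat C 24, ← C_mul]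
      norm_num
    simp only [Fin.sum_univ_four, Matrix.cons_val]
    linear_combination (-a * b * c) * hC

/-- A product of three linearly independent linear forms has Waring rank 4. -/
theorem rank_triangle (a b c : Ternary)
    (ha : IsLinearForm a) (hb : IsLinearForm b) (hc : IsLinearForm c)
    (hind : LinearIndependent ℂ ![a, b, c]) :
    waringRank 3 (a * b * c) = 4 := by
  refine le_antisymm (Nat.sInf_le (exists_mul_eq_sum_four_cubes ha hb hc))
    (le_csInf ⟨4, exists_mul_eq_sum_four_cubes ha hb hc⟩ ?_)
  rintro r ⟨l, hl, h⟩
  by_contra! hr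
  have hzero : IsLinearForm 0 := isHomogeneous_zero _ _ _
  refine mul_ne_sum_three_cubes ha hb hc hind
    (fun i => if hi : i.val < r then l ⟨i, hi⟩ else 0) (fun i => ?_) ?_
  · split_ifs
    exacts [hl _, hzero]
  · rw [h]
    interval_cases r <;> simp [Fin.sum_univ_succ]
end

section
/- Let p, q ∈ ℂ and let f = x₂²·x₃ − (x₁³ + p·x₁·x₃² + q·x₃³) (the Weierstrass form). Then the Waring rank of f equals 3 if p = 0 and q ≠ 0, and equals 4 otherwise. -/
open MvPolynomial

/-- The form `f` is a sum of `r` `d`-th powers of linear forms. -/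
def IsSumOfPowers (d : ℕ) (f : Ternary) (r : ℕ) : Prop :=
  ∃ l : Fin r → Ternary, (∀ i, IsLinearForm (l i)) ∧ f = ∑ i, (l i) ^ d

lemma IsSumOfPowers.succ {d : ℕ} (hd : d ≠ 0) {f : Ternary} {r : ℕ}
    (h : IsSumOfPowers d f r) : IsSumOfPowers d f (r + 1) := by
  obtain ⟨l, hl, rfl⟩ := h
  refine ⟨Fin.cons 0 l, Fin.cases (isHomogeneous_zero _ _ _) hl, ?_⟩
  simp [Fin.sum_univ_succ, hd]

lemma IsSumOfPowers.mono {d : ℕ} (hd : d ≠ 0) {f : Ternary} {r s : ℕ}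
    (h : IsSumOfPowers d f r) (hrs : r ≤ s) : IsSumOfPowers d f s :=
  Nat.le_induction h (fun _ _ => IsSumOfPowers.succ hd) s hrs

lemma waringRank_eq_succ {d : ℕ} (hd : d ≠ 0) {f : Ternary} {r : ℕ}
    (h : IsSumOfPowers d f (r + 1)) (h' : ¬ IsSumOfPowers d f r) :
    waringRank d f = r + 1 := by
  refine le_antisymm (Nat.sInf_le h) (le_csInf ⟨_, h⟩ fun s hs => ?_)
  by_contra! hlt
  exact h' (IsSumOfPowers.mono hd hs (Nat.lt_succ_iff.mp hlt))

lemma IsLinearForm.exists_eval_eq {l : Ternary} (hl : IsLinearForm l) :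
    ∃ u : Fin 3 → ℂ, ∀ v : Fin 3 → ℂ, eval v l = u 0 * v 0 + u 1 * v 1 + u 2 * v 2 := by
  have h : l ∈ homogeneousSubmodule (Fin 3) ℂ 1 := hl
  rw [homogeneousSubmodule_one_eq_span_X, Submodule.mem_span_range_iff_exists_fun] at h
  obtain ⟨u, rfl⟩ := h
  exact ⟨u, fun v => by simp [Fin.sum_univ_three, smul_eval]⟩

lemma IsLinearForm.exists_pow_eq {d : ℕ} (hd : 0 < d) {l : Ternary} (hl : IsLinearForm l)
    (k : ℂ) : ∃ m : Ternary, IsLinearForm m ∧ m ^ d = C k * l ^ d := by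
  obtain ⟨c, hc⟩ := IsAlgClosed.exists_pow_nat_eq k hd
  exact ⟨C c * l, IsHomogeneous.C_mul hl c, by rw [mul_pow, ← map_pow, hc]⟩

/-- The Weierstrass form with parameters `p` and `q`. -/
noncomputable def weierstrassForm (p q : ℂ) : Ternary :=
  (X 1 : Ternary) ^ 2 * X 2
    - ((X 0) ^ 3 + MvPolynomial.C p * X 0 * (X 2) ^ 2 + MvPolynomial.C q * (X 2) ^ 3)

/-- The moments of the coefficient vectors of three linear forms whose cubes add up to a
Weierstrass form. -/
structure IsWeierstrassDecomposition (p q : ℂ) (a b c : Fin 3 → ℂ) : Prop where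
  aaa : ∑ i, a i * a i * a i = -1
  aab : ∑ i, a i * a i * b i = 0
  aac : ∑ i, a i * a i * c i = 0
  abb : ∑ i, a i * b i * b i = 0
  abc : ∑ i, a i * b i * c i = 0
  acc : ∑ i, a i * c i * c i = -p / 3
  bbb : ∑ i, b i * b i * b i = 0
  bbc : ∑ i, b i * b i * c i = 1 / 3
  bcc : ∑ i, b i * c i * c i = 0
  ccc : ∑ i, c i * c i * c i = -q

lemma exists_isWeierstrassDecomposition {p q : ℂ} {l : Fin 3 → Ternary}
    (hl : ∀ i, IsLinearForm (l i)) (h : weierstrassForm p q = ∑ i, (l i) ^ 3) :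
    ∃ a b c : Fin 3 → ℂ, IsWeierstrassDecomposition p q a b c ∧
      ∀ i, l i = 0 → a i = 0 ∧ b i = 0 ∧ c i = 0 := by
  choose u hu using fun i => (hl i).exists_eval_eq
  have H (x y z : ℂ) : y ^ 2 * z - (x ^ 3 + p * x * z ^ 2 + q * z ^ 3) =
      ∑ i, (u i 0 * x + u i 1 * y + u i 2 * z) ^ 3 := by
    simpa [weierstrassForm, hu] using congrArg (eval ![x, y, z]) h
  refine ⟨fun i => u i 0, fun i => u i 1, fun i => u i 2, ?_, fun i hi => ?_⟩
  · simp only [Fin.sum_univ_three] at H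
    constructor <;> simp only [Fin.sum_univ_three]
    · linear_combination -H 1 0 0
    · linear_combination (-H 1 1 0 + H 1 (-1) 0 + 2 * H 0 1 0) / 6
    · linear_combination (-H 1 0 1 + H 1 0 (-1) + 2 * H 0 0 1) / 6
    · linear_combination (-H 1 1 0 - H 1 (-1) 0 + 2 * H 1 0 0) / 6
    · linear_combination (-H 1 1 1 + H 1 1 0 + H 1 0 1 + H 0 1 1
        - H 1 0 0 - H 0 1 0 - H 0 0 1) / 6
    · linear_combination (-H 1 0 1 - H 1 0 (-1) + 2 * H 1 0 0) / 6
    · linear_combination -H 0 1 0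
    · linear_combination (-H 0 1 1 + H 0 1 (-1) + 2 * H 0 0 1) / 6
    · linear_combination (-H 0 1 1 - H 0 1 (-1) + 2 * H 0 1 0) / 6
    · linear_combination -H 0 0 1
  · have hz (v : Fin 3 → ℂ) := hu i v
    simp only [hi, map_zero] at hz
    exact ⟨by simpa using (hz ![1, 0, 0]).symm, by simpa using (hz ![0, 1, 0]).symm,
      by simpa using (hz ![0, 0, 1]).symm⟩

namespace IsWeierstrassDecomposition

variable {p q : ℂ} {a b c : Fin 3 → ℂ}

/-- The three linear forms are linearly independent, as the Weierstrass form is not a form in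
fewer variables. -/
lemma eq_zero_of_sum_eq_zero (h : IsWeierstrassDecomposition p q a b c) {w : Fin 3 → ℂ}
    (ha : ∑ i, w i * a i = 0) (hb : ∑ i, w i * b i = 0) (hc : ∑ i, w i * c i = 0) : w = 0 := by
  obtain ⟨haaa, haab, haac, habb, habc, hacc, hbbb, hbbc, hbcc, hccc⟩ := h
  simp only [Fin.sum_univ_three] at *
  let M : Matrix (Fin 3) (Fin 3) ℂ := Matrix.of fun i => ![a i, b i, c i]
  have hM : M.det ≠ 0 := by
    rw [Ne, ← Matrix.exists_mulVec_eq_zero_iff]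
    rintro ⟨v, hv, hMv⟩
    have hv' (i : Fin 3) : a i * v 0 + b i * v 1 + c i * v 2 = 0 := by
      simpa [M, Matrix.mulVec, dotProduct, Fin.sum_univ_three] using congrFun hMv i
    have e0 := hv' 0
    have e1 := hv' 1
    have e2 := hv' 2
    have hv0 : v 0 = 0 := by
      linear_combination v 0 * haaa + v 1 * haab + v 2 * haac
        - (a 0 * a 0 * e0 + a 1 * a 1 * e1 + a 2 * a 2 * e2)
    have hv1 : v 1 = 0 := by
      linear_combination 3 * (-v 0 * habc - v 1 * hbbc - v 2 * hbcc
        + (b 0 * c 0 * e0 + b 1 * c 1 * e1 + b 2 * c 2 * e2))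
    have hv2 : v 2 = 0 := by
      linear_combination 3 * (-v 0 * habb - v 1 * hbbb - v 2 * hbbc
        + (b 0 * b 0 * e0 + b 1 * b 1 * e1 + b 2 * b 2 * e2))
    exact hv (by ext i; fin_cases i <;> assumption)
  refine Matrix.eq_zero_of_vecMul_eq_zero hM ?_
  ext i
  fin_cases i <;> simpa [M, Matrix.vecMul, dotProduct, Fin.sum_univ_three]

lemma ne_zero (h : IsWeierstrassDecomposition p q a b c) (i : Fin 3) :
    ¬ (a i = 0 ∧ b i = 0 ∧ c i = 0) := by
  rintro ⟨ha, hb, hc⟩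
  have := h.eq_zero_of_sum_eq_zero (w := Pi.single i 1)
    (by simp [Pi.single_apply, ha]) (by simp [Pi.single_apply, hb])
    (by simp [Pi.single_apply, hc])
  simpa using congrFun this i

/-- The quadric `xy` is apolar to the Weierstrass form. -/
lemma mul_eq_zero (h : IsWeierstrassDecomposition p q a b c) (i : Fin 3) : a i * b i = 0 := by
  obtain ⟨haaa, haab, haac, habb, habc, hacc, hbbb, hbbc, hbcc, hccc⟩ := id h
  simp only [Fin.sum_univ_three] at *
  refine congrFun (h.eq_zero_of_sum_eq_zero (w := fun i => a i * b i) ?_ ?_ ?_) i <;>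
    simp only [Fin.sum_univ_three]
  · linear_combination haab
  · linear_combination habb
  · linear_combination habc

/-- The quadric `xz + p y²` is apolar to the Weierstrass form. -/
lemma mul_add_mul_eq_zero (h : IsWeierstrassDecomposition p q a b c) (i : Fin 3) :
    a i * c i + p * (b i * b i) = 0 := by
  obtain ⟨haaa, haab, haac, habb, habc, hacc, hbbb, hbbc, hbcc, hccc⟩ := id h
  simp only [Fin.sum_univ_three] at *
  refine congrFun (h.eq_zero_of_sum_eq_zero
    (w := fun i => a i * c i + p * (b i * b i)) ?_ ?_ ?_) i <;>
    simp only [Fin.sum_univ_three]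
  · linear_combination haac + p * habb
  · linear_combination habc + p * hbbb
  · linear_combination hacc + p * hbbc

/-- The quadric `3 z² - p x² + 9 q y²` is apolar to the Weierstrass form. -/
lemma mul_self_eq (h : IsWeierstrassDecomposition p q a b c) (i : Fin 3) :
    3 * (c i * c i) - p * (a i * a i) + 9 * q * (b i * b i) = 0 := by
  obtain ⟨haaa, haab, haac, habb, habc, hacc, hbbb, hbbc, hbcc, hccc⟩ := id h
  simp only [Fin.sum_univ_three] at *
  refine congrFun (h.eq_zero_of_sum_eq_zero
    (w := fun i => 3 * (c i * c i) - p * (a i * a i) + 9 * q * (b i * b i)) ?_ ?_ ?_) i <;>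
    simp only [Fin.sum_univ_three]
  · linear_combination 3 * hacc - p * haaa + 9 * q * habb
  · linear_combination 3 * hbcc - p * haab + 9 * q * hbbb
  · linear_combination 3 * hccc - p * haac + 9 * q * hbbc

lemma eq_zero_and_ne_zero (h : IsWeierstrassDecomposition p q a b c) : p = 0 ∧ q ≠ 0 := by
  have hbc : ¬ ∀ i, b i * c i = 0 := fun h0 => by
    have := h.bbc
    simp [mul_assoc, h0] at this
  have hp : p = 0 := by
    by_contra hp
    refine hbc fun i => ?_
    rcases _root_.mul_eq_zero.mp (h.mul_eq_zero i) with ha | hb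
    · have hb : b i = 0 := by simpa [ha, hp] using h.mul_add_mul_eq_zero i
      simp [hb]
    · simp [hb]
  refine ⟨hp, fun hq => hbc fun i => ?_⟩
  have hc : c i = 0 := by simpa [hp, hq] using h.mul_self_eq i
  simp [hc]

end IsWeierstrassDecomposition

lemma not_isSumOfPowers_weierstrassForm_two (p q : ℂ) :
    ¬ IsSumOfPowers 3 (weierstrassForm p q) 2 := by
  rintro ⟨l, hl, h⟩
  obtain ⟨a, b, c, habc, hz⟩ := exists_isWeierstrassDecomposition (p := p) (q := q)
    (l := Fin.cons 0 l) (Fin.cases (isHomogeneous_zero _ _ _) hl)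
    (by rw [h, Fin.sum_univ_succ (n := 2)]; simp)
  exact habc.ne_zero 0 (hz 0 rfl)

lemma not_isSumOfPowers_weierstrassForm_three {p q : ℂ} (hpq : ¬ (p = 0 ∧ q ≠ 0)) :
    ¬ IsSumOfPowers 3 (weierstrassForm p q) 3 := by
  rintro ⟨l, hl, h⟩
  obtain ⟨a, b, c, habc, -⟩ := exists_isWeierstrassDecomposition hl h
  exact hpq habc.eq_zero_and_ne_zero

lemma isLinearForm_X (i : Fin 3) : IsLinearForm (X i) := isHomogeneous_X _ _

lemma isLinearForm_C_mul_X_add_C_mul_X (a b : ℂ) (i j : Fin 3) :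
    IsLinearForm (C a * X i + C b * X j) :=
  (isHomogeneous_C_mul_X a i).add (isHomogeneous_C_mul_X b j)

/-- Decompose `y² z + 2 k z³` into two cubes, leaving a form in `x` and `z`. -/
lemma exists_weierstrassForm_eq (p q : ℂ) {k : ℂ} (hk : k ≠ 0) :
    ∃ l₁ l₂ : Ternary, IsLinearForm l₁ ∧ IsLinearForm l₂ ∧
      weierstrassForm p q = l₁ ^ 3 + l₂ ^ 3
        - (X 0 ^ 3 + C p * X 0 * X 2 ^ 2 + C (q + 2 * k) * X 2 ^ 3) := by
  obtain ⟨t, ht⟩ := IsAlgClosed.exists_pow_nat_eq (1 / (6 * k)) two_pos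
  have hkt : 6 * k * t ^ 2 = 1 := by rw [ht]; field_simp
  obtain ⟨l₁, hl₁, h₁⟩ := (isLinearForm_C_mul_X_add_C_mul_X 1 t 2 1).exists_pow_eq three_pos k
  obtain ⟨l₂, hl₂, h₂⟩ :=
    (isLinearForm_C_mul_X_add_C_mul_X 1 (-t) 2 1).exists_pow_eq three_pos k
  refine ⟨l₁, l₂, hl₁, hl₂, ?_⟩
  rw [h₁, h₂]
  refine MvPolynomial.funext fun v => ?_
  simp only [weierstrassForm, map_add, map_sub, map_mul, map_pow, eval_C, eval_X]
  linear_combination -(v 1 ^ 2 * v 2) * hkt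

lemma isSumOfPowers_weierstrassForm_three {q : ℂ} (hq : q ≠ 0) :
    IsSumOfPowers 3 (weierstrassForm 0 q) 3 := by
  obtain ⟨l₁, l₂, hl₁, hl₂, h⟩ :=
    exists_weierstrassForm_eq 0 q (k := -q / 2) (by simpa using hq)
  obtain ⟨m, hm, hm'⟩ := (isLinearForm_X 0).exists_pow_eq three_pos (-1)
  refine ⟨![l₁, l₂, m], by simp [Fin.forall_fin_succ, *], ?_⟩
  rw [h]
  simp [Fin.sum_univ_three, hm', mul_div_cancel₀]
  ring

lemma exists_mul_eq_and_add_ne {p : ℂ} (hp : p ≠ 0) (q : ℂ) :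
    ∃ α β : ℂ, α ≠ β ∧ p = -(3 * (α * β)) ∧ p / 3 * (α + β) ≠ q := by
  let x : Polynomial ℂ := Polynomial.X
  let P : Polynomial ℂ := x * (3 * x ^ 2 + Polynomial.C p) *
    (3 * Polynomial.C p * x ^ 2 - 9 * Polynomial.C q * x - Polynomial.C p ^ 2)
  have hP : P ≠ 0 := by
    refine mul_ne_zero (mul_ne_zero Polynomial.X_ne_zero fun h => ?_) fun h => ?_ <;>
      simpa [x, hp] using congrArg (Polynomial.eval 0) h
  obtain ⟨α, hα⟩ : ∃ α, P.eval α ≠ 0 := by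
    by_contra! h
    exact hP (Polynomial.funext fun y => by rw [h y, Polynomial.eval_zero])
  simp only [P, x, Polynomial.eval_mul, Polynomial.eval_X, Polynomial.eval_add,
    Polynomial.eval_sub, Polynomial.eval_pow, Polynomial.eval_C, Polynomial.eval_ofNat, Ne,
    mul_eq_zero, not_or] at hα
  obtain ⟨⟨h₀, h₁⟩, h₂⟩ := hα
  refine ⟨α, -p / (3 * α), fun h => h₁ ?_, by field_simp, fun h => h₂ ?_⟩
  · field_simp at h
    linear_combination h
  · field_simp at h
    linear_combination h

lemma isSumOfPowers_weierstrassForm_four (p q : ℂ) (hpq : ¬ (p = 0 ∧ q ≠ 0)) :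
    IsSumOfPowers 3 (weierstrassForm p q) 4 := by
  by_cases hp : p = 0
  · obtain rfl : q = 0 := by simpa [hp] using hpq
    subst hp
    obtain ⟨l₁, l₂, hl₁, hl₂, h⟩ := exists_weierstrassForm_eq 0 0 (k := 1 / 2) (by simp)
    obtain ⟨m, hm, hm'⟩ := (isLinearForm_X 0).exists_pow_eq three_pos (-1)
    obtain ⟨n, hn, hn'⟩ := (isLinearForm_X 2).exists_pow_eq three_pos (-1)
    refine ⟨![l₁, l₂, m, n], by simp [Fin.forall_fin_succ, *], ?_⟩
    rw [h]
    simp [Fin.sum_univ_four, hm', hn']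
    ring
  · obtain ⟨α, β, h₁, hαβ, h₂⟩ := exists_mul_eq_and_add_ne hp q
    have hd : β - α ≠ 0 := sub_ne_zero.mpr h₁.symm
    obtain ⟨l₁, l₂, hl₁, hl₂, h⟩ := exists_weierstrassForm_eq p q
      (k := (p / 3 * (α + β) - q) / 2) (by simpa [sub_eq_zero] using h₂)
    obtain ⟨m, hm, hm'⟩ := (isLinearForm_C_mul_X_add_C_mul_X 1 α 0 2).exists_pow_eq three_pos
      (-β / (β - α))
    obtain ⟨n, hn, hn'⟩ := (isLinearForm_C_mul_X_add_C_mul_X 1 β 0 2).exists_pow_eq three_pos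
      (α / (β - α))
    refine ⟨![l₁, l₂, m, n], by simp [Fin.forall_fin_succ, *], ?_⟩
    have hmn : m ^ 3 + n ^ 3 =
        -(X 0 ^ 3 + C p * X 0 * X 2 ^ 2 + C (p / 3 * (α + β)) * X 2 ^ 3) := by
      rw [hm', hn']
      refine MvPolynomial.funext fun v => ?_
      simp only [hαβ, map_add, map_neg, map_mul, map_pow, eval_C, eval_X]
      field_simp
      ring
    have hc : q + 2 * ((p / 3 * (α + β) - q) / 2) = p / 3 * (α + β) := by ring
    rw [h, hc, sub_eq_add_neg, ← hmn]
    simp [Fin.sum_univ_four, add_assoc]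

/-- Waring rank of the Weierstrass form `x₂² x₃ - (x₁³ + p x₁ x₃² + q x₃³)`. -/
theorem rank_weierstrass_form (p q : ℂ) :
    (p = 0 ∧ q ≠ 0 →
      waringRank 3 ((X 1 : Ternary) ^ 2 * X 2
        - ((X 0) ^ 3 + MvPolynomial.C p * X 0 * (X 2) ^ 2
          + MvPolynomial.C q * (X 2) ^ 3)) = 3) ∧
    (¬ (p = 0 ∧ q ≠ 0) →
      waringRank 3 ((X 1 : Ternary) ^ 2 * X 2
        - ((X 0) ^ 3 + MvPolynomial.C p * X 0 * (X 2) ^ 2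
          + MvPolynomial.C q * (X 2) ^ 3)) = 4) := by
  refine ⟨?_, fun hpq => waringRank_eq_succ three_ne_zero
    (isSumOfPowers_weierstrassForm_four p q hpq) (not_isSumOfPowers_weierstrassForm_three hpq)⟩
  rintro ⟨rfl, hq⟩
  exact waringRank_eq_succ three_ne_zero (isSumOfPowers_weierstrassForm_three hq)
    (not_isSumOfPowers_weierstrassForm_two 0 q)
end
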